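/- arXiv:2502.00765 — 5 statements merged into one kernel-verified Lean document; each statement's English description precedes it below -/
import Mathlib

section
/- Let α be a type with decidable equality, T and C natural numbers, h : α → Fin T a hash function, g : Finset α → Fin C an arbitrary classifier, and S, S' : Finset α. Then the number of indices i : Fin T with g(fiber_i(S)) ≠ g(fiber_i(S')) is at most the cardinality of the symmetric difference S Δ S'. -/
/-- The `i`-th fiber of a finset `S` under the hash function `h`:
the elements of `S` hashed to index `i`. -/
def fiber {α : Type*} [DecidableEq α] {T : ℕ} (h : α → Fin T) (S : Finset α) (i : Fin T) :
    Finset α :=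
  S.filter (fun e => h e = i)

/-- If the fibers of `S` and `S'` over `i` differ, then some element of `S Δ S'` is hashed
to `i`. -/
theorem mem_image_symmDiff_of_fiber_ne {α : Type*} [DecidableEq α] {T : ℕ} {h : α → Fin T}
    {S S' : Finset α} {i : Fin T} (hne : fiber h S i ≠ fiber h S' i) :
    i ∈ (symmDiff S S').image h := by
  contrapose! hne
  ext e
  have he : h e = i → e ∉ symmDiff S S' := fun hi hmem =>
    hne (Finset.mem_image.mpr ⟨e, hmem, hi⟩)
  simp only [Finset.mem_symmDiff] at he
  simp only [fiber, Finset.mem_filter]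
  tauto

/-- For any classifier `g`, the number of indices at which the predictions of `g` on the
fibers of `S` and of `S'` differ is at most the cardinality of `S Δ S'`. -/
theorem card_pred_ne_le_card_symmDiff {α : Type*} [DecidableEq α] {T C : ℕ}
    (h : α → Fin T) (g : Finset α → Fin C) (S S' : Finset α) :
    (Finset.univ.filter (fun i : Fin T => g (fiber h S i) ≠ g (fiber h S' i))).card ≤
      (symmDiff S S').card := by
  refine (Finset.card_le_card fun i hi => ?_).trans
    (Finset.card_image_le (s := symmDiff S S') (f := h))
  exact mem_image_symmDiff_of_fiber_ne fun heq =>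
    (Finset.mem_filter.mp hi).2 (congrArg g heq)
end

section
/- Let V be a type with decidable equality, T a natural number, h : V → Fin T a hash function on nodes, and E, E' : Finset (V × V) two sets of directed edges. Suppose every directed edge in the symmetric difference E Δ E' has its source in a finset S : Finset V. Then the number of indices i : Fin T with dfiber_i(E) ≠ dfiber_i(E') is at most |S|. -/
/-- The `i`-th source-fiber of a finset of directed edges `E` under the node hash
function `h`: the directed edges whose source node is hashed to index `i`. -/
def dfiber {V : Type*} [DecidableEq V] {T : ℕ} (h : V → Fin T)
    (E : Finset (V × V)) (i : Fin T) : Finset (V × V) :=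
  E.filter (fun e => h e.1 = i)

/-- If every directed edge in `E Δ E'` has its source in `S`, then the number of indices
at which the source-fibers of `E` and `E'` differ is at most `|S|`. -/
theorem card_dfiber_ne_le {V : Type*} [DecidableEq V] {T : ℕ}
    (h : V → Fin T) (E E' : Finset (V × V)) (S : Finset V)
    (hS : ∀ e ∈ symmDiff E E', e.1 ∈ S) :
    (Finset.univ.filter (fun i : Fin T => dfiber h E i ≠ dfiber h E' i)).card ≤ S.card := by
  refine (Finset.card_le_card fun i hi => ?_).trans (Finset.card_image_le (s := S) (f := h))
  rw [Finset.mem_filter] at hi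
  by_contra hiS
  refine hi.2 (Finset.ext fun e => ?_)
  simp only [dfiber, Finset.mem_filter]
  refine and_congr_left fun he => ?_
  by_contra hne
  refine hiS (Finset.mem_image.2 ⟨e.1, hS e ?_, he⟩)
  rw [Finset.mem_symmDiff]
  tauto
end

section
/- Let V be a type with decidable equality, T and C natural numbers, h : V → Fin T a hash function on nodes, g : Finset (V × V) → Fin C an arbitrary classifier, and E, E' : Finset (V × V) two sets of directed edges. Suppose every directed edge in the symmetric difference E Δ E' has its source in a finset S : Finset V. Then the number of indices i : Fin T with g(dfiber_i(E)) ≠ g(dfiber_i(E')) is at most |S|. -/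
/-- For any classifier `g`, if every directed edge in `E Δ E'` has its source in `S`, then
the number of indices at which the predictions of `g` on the source-fibers of `E` and of
`E'` differ is at most `|S|`. -/
theorem card_dfiber_pred_ne_le {V : Type*} [DecidableEq V] {T C : ℕ}
    (h : V → Fin T) (g : Finset (V × V) → Fin C) (E E' : Finset (V × V)) (S : Finset V)
    (hS : ∀ e ∈ symmDiff E E', e.1 ∈ S) :
    (Finset.univ.filter (fun i : Fin T => g (dfiber h E i) ≠ g (dfiber h E' i))).card ≤
      S.card := by
  refine (Finset.card_le_card fun i hi => ?_).trans (Finset.card_image_le (s := S) (f := h))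
  by_contra hiS
  refine (Finset.mem_filter.mp hi).2 (congrArg g (Finset.ext fun e => ?_))
  simp only [dfiber, Finset.mem_filter]
  refine and_congr_left fun he => ?_
  by_contra hne
  refine hiS (Finset.mem_image.mpr ⟨e.1, hS e ?_, he⟩)
  rw [Finset.mem_symmDiff]
  tauto
end

section
/- Let V be a type with decidable equality, T a natural number, h : V → Fin T a hash function on nodes, and E, E' : Finset (V × V) two sets of directed edges. Suppose there exist a finset of directed edges A : Finset (V × V) and a finset of nodes S : Finset V such that every edge e ∈ E Δ E' satisfies e ∈ A or e.1 ∈ S. Then the number of indices i : Fin T with dfiber_i(E) ≠ dfiber_i(E') is at most |A| + |S|. -/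
/-- If the source-fibers of `E` and `E'` differ at `i`, then some edge of `E Δ E'` has its
source hashed to `i`. -/
theorem exists_mem_symmDiff_of_dfiber_ne {V : Type*} [DecidableEq V] {T : ℕ}
    {h : V → Fin T} {E E' : Finset (V × V)} {i : Fin T} (hi : dfiber h E i ≠ dfiber h E' i) :
    ∃ e ∈ symmDiff E E', h e.1 = i := by
  contrapose! hi
  ext e
  simp only [dfiber, Finset.mem_filter, and_congr_left_iff]
  intro he
  have hmem : e ∉ symmDiff E E' := fun hmem => hi e hmem he
  rw [Finset.mem_symmDiff] at hmem
  tauto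

/-- If every edge in `E Δ E'` either lies in a finset of edges `A` or has its source in a
finset of nodes `S`, then the number of indices at which the source-fibers of `E` and `E'`
differ is at most `|A| + |S|`. -/
theorem card_dfiber_ne_le_add {V : Type*} [DecidableEq V] {T : ℕ}
    (h : V → Fin T) (E E' : Finset (V × V)) (A : Finset (V × V)) (S : Finset V)
    (hcover : ∀ e ∈ symmDiff E E', e ∈ A ∨ e.1 ∈ S) :
    (Finset.univ.filter (fun i : Fin T => dfiber h E i ≠ dfiber h E' i)).card ≤
      A.card + S.card := by
  have hsub : Finset.univ.filter (fun i : Fin T => dfiber h E i ≠ dfiber h E' i) ⊆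
      A.image (fun e => h e.1) ∪ S.image h := by
    intro i hi
    obtain ⟨e, he, rfl⟩ := exists_mem_symmDiff_of_dfiber_ne (Finset.mem_filter.mp hi).2
    rcases hcover e he with hA | hS
    · exact Finset.mem_union_left _ (Finset.mem_image_of_mem (fun e => h e.1) hA)
    · exact Finset.mem_union_right _ (Finset.mem_image_of_mem h hS)
  exact (Finset.card_le_card hsub).trans <| (Finset.card_union_le _ _).trans <|
    add_le_add Finset.card_image_le Finset.card_image_le
end

section
/- Let α be a type with decidable equality, T and C natural numbers, h : α → Fin T a hash function, g : Finset α → Fin C an arbitrary classifier, and S, S' : Finset α. Suppose the symmetric difference decomposes as a subset of a union S Δ S' ⊆ A₁ ∪ A₂ ∪ A₃ for finsets A₁, A₂, A₃ : Finset α. Then the number of indices i : Fin T with g(fiber_i(S)) ≠ g(fiber_i(S')) is at most |A₁| + |A₂| + |A₃|. -/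
/-- For any classifier `g`, if `S Δ S' ⊆ A₁ ∪ A₂ ∪ A₃`, then the number of indices at
which the predictions of `g` on the fibers of `S` and of `S'` differ is at most
`|A₁| + |A₂| + |A₃|`. -/
theorem card_pred_ne_le_of_symmDiff_subset_union {α : Type*} [DecidableEq α] {T C : ℕ}
    (h : α → Fin T) (g : Finset α → Fin C) (S S' : Finset α) (A₁ A₂ A₃ : Finset α)
    (hcover : symmDiff S S' ⊆ A₁ ∪ A₂ ∪ A₃) :
    (Finset.univ.filter (fun i : Fin T => g (fiber h S i) ≠ g (fiber h S' i))).card ≤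
      A₁.card + A₂.card + A₃.card := by
  calc
    _ ≤ ((symmDiff S S').image h).card := by
      refine Finset.card_le_card fun i hi => mem_image_symmDiff_of_fiber_ne fun heq => ?_
      exact (Finset.mem_filter.mp hi).2 (congrArg g heq)
    _ ≤ (symmDiff S S').card := Finset.card_image_le
    _ ≤ (A₁ ∪ A₂ ∪ A₃).card := Finset.card_le_card hcover
    _ ≤ (A₁ ∪ A₂).card + A₃.card := Finset.card_union_le _ _
    _ ≤ A₁.card + A₂.card + A₃.card := Nat.add_le_add_right (Finset.card_union_le _ _) _
end
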